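/- Let ℓ : [0,∞) → [0,∞) be a regular distinguishability function (ℓ(‖v₁ − v₃‖) ≤ ℓ(‖v₁ − v₂‖) + ℓ(‖v₂ − v₃‖) for all v₁, v₂, v₃ ∈ ℝ²), and let X ⊆ ℝ² be a closed disk with V_X = {j − i : i, j ∈ X}, D_X = {(‖v‖, ‖v′‖) : v, v′ ∈ ℝ², v′ − v ∈ V_X}, and ℓ_X(r, r′) = inf { ℓ(‖v − v′‖) : ‖v‖ = r, ‖v′‖ = r′, v − v′ ∈ V_X }. For every noise function f (a probability density on ℝ²) satisfying ℓ-privacy on X (i.e., there is a Lebesgue-null set N ⊂ ℝ² with f(v) ≤ e^{ℓ(‖v − v′‖)} · f(v′) for all v, v′ ∉ N with v − v′ ∈ V_X) and every measurable loss function loss : [0,∞) → [0,∞), there exists a radial R : [0,∞) → [0,∞) such that the circular noise function f_R(v) = R(‖v‖) is a probability density, has the same expected loss as f (∫_{ℝ²} f_R(v)·loss(‖v‖) dλ(v) = ∫_{ℝ²} f(v)·loss(‖v‖) dλ(v)), and strictly satisfies ℓ-privacy on X: R(r) ≤ e^{ℓ_X(r, r′)} · R(r′) for ALL (r, r′) ∈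 D_X. -/

import Mathlib

open MeasureTheory Real

section helpers

open Set Filter Topology
open scoped ENNReal

instance factTwoPi : Fact (0 < 2 * π) := ⟨Real.two_pi_pos⟩

/-- integral of `g` over the circle of radius `r` (with respect to the angle). -/
noncomputable def cavg (g : ℂ → ℝ≥0∞) (r : ℝ) : ℝ≥0∞ :=
  ∫⁻ θ : AddCircle (2 * π), g (r * (AddCircle.toCircle θ : ℂ))

lemma measurable_pt : Measurable
    (fun p : ℝ × AddCircle (2 * π) => ((p.1 : ℂ) * (AddCircle.toCircle p.2 : ℂ))) := by
  apply Continuous.measurable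
  have := @AddCircle.continuous_toCircle (2 * π)
  fun_prop

lemma measurable_cavg {g : ℂ → ℝ≥0∞} (hg : Measurable g) : Measurable (cavg g) := by
  unfold cavg
  exact Measurable.lintegral_prod_right' (f := fun p : ℝ × AddCircle (2 * π) =>
    g ((p.1 : ℂ) * (AddCircle.toCircle p.2 : ℂ))) (hg.comp measurable_pt)

lemma cavg_rot (g : ℂ → ℝ≥0∞) (r : ℝ) (α : AddCircle (2 * π)) :
    cavg g r = ∫⁻ θ : AddCircle (2 * π), g (r * (AddCircle.toCircle (θ + α) : ℂ)) := by
  unfold cavg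
  exact (lintegral_add_right_eq_self
    (fun θ : AddCircle (2 * π) => g (r * (AddCircle.toCircle θ : ℂ))) α).symm

lemma cavg_eq (g : ℂ → ℝ≥0∞) (r : ℝ) :
    cavg g r = ∫⁻ θ in Ioo (-π) π, g (Complex.polarCoord.symm (r, θ)) := by
  unfold cavg
  rw [← AddCircle.lintegral_preimage (2 * π) (-π)]
  have : -π + 2 * π = π := by ring
  rw [this, ← restrict_Ioo_eq_restrict_Ioc]
  apply lintegral_congr
  intro θ
  rw [AddCircle.toCircle_apply_mk, Complex.polarCoord_symm_apply, Circle.coe_exp,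
    div_self Real.two_pi_pos.ne', one_mul, Complex.exp_mul_I]
  simp

lemma lintegral_polar {g : ℂ → ℝ≥0∞} (hg : Measurable g) :
    ∫⁻ z, g z = ∫⁻ r in Ioi (0 : ℝ), ENNReal.ofReal r * cavg g r := by
  rw [← Complex.lintegral_comp_polarCoord_symm, polarCoord_target, Measure.volume_eq_prod,
    ← Measure.prod_restrict]
  have hm : Measurable (fun p : ℝ × ℝ => g (Complex.polarCoord.symm p)) := by
    refine hg.comp ?_
    have : (fun p : ℝ × ℝ => Complex.polarCoord.symm p)
        = fun p : ℝ × ℝ => (p.1 : ℂ) * (Real.cos p.2 + Real.sin p.2 * Complex.I) := by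
      funext p; exact Complex.polarCoord_symm_apply p
    show Measurable (fun p : ℝ × ℝ => Complex.polarCoord.symm p)
    rw [this]
    fun_prop
  rw [lintegral_prod]
  · apply lintegral_congr
    intro r
    simp only [smul_eq_mul]
    rw [lintegral_const_mul, cavg_eq]
    exact hm.comp (measurable_const.prodMk measurable_id)
  · simp only [smul_eq_mul]
    exact (((ENNReal.measurable_ofReal.comp measurable_fst).mul hm)).aemeasurable

lemma lintegral_radial {h : ℝ → ℝ≥0∞} (hh : AEMeasurable h (volume.restrict (Ioi (0 : ℝ)))) :
    ∫⁻ z : ℂ, h ‖z‖ = ∫⁻ r in Ioi (0 : ℝ), ENNReal.ofReal r * (h r * ENNReal.ofReal (2 * π)) := by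
  rw [← Complex.lintegral_comp_polarCoord_symm (fun z => h ‖z‖), polarCoord_target]
  have h1 : ∫⁻ p in Ioi (0 : ℝ) ×ˢ Ioo (-π) π,
      ENNReal.ofReal p.1 • h ‖Complex.polarCoord.symm p‖
      = ∫⁻ p in Ioi (0 : ℝ) ×ˢ Ioo (-π) π, (ENNReal.ofReal p.1 * h p.1) * 1 := by
    apply setLIntegral_congr_fun (measurableSet_Ioi.prod measurableSet_Ioo)
    intro p hp
    simp only [Complex.norm_polarCoord_symm, smul_eq_mul, mul_one]
    rw [abs_of_pos hp.1]
  rw [h1, Measure.volume_eq_prod, ← Measure.prod_restrict,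
    lintegral_prod_mul (f := fun r => ENNReal.ofReal r * h r) (g := fun _ => (1 : ℝ≥0∞))
      (ENNReal.measurable_ofReal.aemeasurable.mul hh) aemeasurable_const]
  simp only [lintegral_const, Measure.restrict_apply MeasurableSet.univ, univ_inter,
    Real.volume_Ioo, one_mul]
  rw [← lintegral_mul_const' _ _ ENNReal.ofReal_ne_top]
  apply lintegral_congr
  intro r
  rw [show π - -π = 2 * π by ring, mul_assoc]

/-- angle realizing a given distance. -/
lemma exists_angle {s s' a : ℝ} (hs : 0 < s) (hs' : 0 < s') (h1 : |s - s'| ≤ a)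
    (h2 : a ≤ s + s') : ∃ α : AddCircle (2 * π),
      ∀ u : Circle, ‖(s : ℂ) * (u * AddCircle.toCircle α : Circle) - s' * u‖ = a := by
  have ha : 0 ≤ a := (abs_nonneg _).trans h1
  set q := (s ^ 2 + s' ^ 2 - a ^ 2) / (2 * s * s') with hq
  have h1' : (s - s') ^ 2 ≤ a ^ 2 := by
    rw [← sq_abs]; gcongr
  have h2' : a ^ 2 ≤ (s + s') ^ 2 := by gcongr
  have q1 : q ≤ 1 := by
    rw [hq, div_le_one (by positivity)]; nlinarith
  have q2 : -1 ≤ q := by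
    rw [hq, le_div_iff₀ (by positivity)]; nlinarith
  refine ⟨((Real.arccos q : ℝ) : AddCircle (2 * π)), fun u => ?_⟩
  rw [AddCircle.toCircle_apply_mk, div_self Real.two_pi_pos.ne', one_mul]
  have : (s : ℂ) * (u * Circle.exp (Real.arccos q) : Circle) - s' * u
      = u * (s * (Circle.exp (Real.arccos q) : ℂ) - s') := by
    push_cast; ring
  rw [this, norm_mul, Circle.norm_coe, one_mul, Circle.coe_exp, Complex.exp_mul_I]
  rw [← Complex.ofReal_cos, ← Complex.ofReal_sin, Real.cos_arccos q2 q1]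
  rw [← sq_eq_sq₀ (norm_nonneg _) ha, Complex.sq_norm, Complex.normSq_apply]
  simp only [Complex.sub_re, Complex.mul_re, Complex.ofReal_re, Complex.add_re, Complex.I_re,
    Complex.I_im, Complex.ofReal_im, Complex.sub_im, Complex.mul_im, Complex.add_im]
  have hsin : Real.sin (Real.arccos q) ^ 2 = 1 - q ^ 2 := by
    rw [Real.sin_arccos, Real.sq_sqrt]; nlinarith
  have hqq : q * (2 * s * s') = s ^ 2 + s' ^ 2 - a ^ 2 := by
    rw [hq]; field_simp
  ring_nf
  rw [hsin]
  nlinarith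

/-- good radii -/
lemma ae_good {N : Set ℂ} (hN : MeasurableSet N) (h0 : volume N = 0) :
    ∀ᵐ r ∂(volume : Measure ℝ), 0 < r → cavg (N.indicator 1) r = 0 := by
  have h := lintegral_polar (g := N.indicator 1) (measurable_one.indicator hN)
  rw [lintegral_indicator_one hN, h0] at h
  have hm := measurable_cavg (g := N.indicator 1) (measurable_one.indicator hN)
  rw [eq_comm, lintegral_eq_zero_iff (by fun_prop)] at h
  have h := (ae_restrict_iff' measurableSet_Ioi).1 h
  filter_upwards [h] with r hr hr0
  have := hr hr0
  simp only [Pi.zero_apply, mul_eq_zero, ENNReal.ofReal_eq_zero] at this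
  rcases this with h | h
  · linarith
  · exact h

lemma good_ae {N : Set ℂ} (hN : MeasurableSet N) {r : ℝ} (h : cavg (N.indicator 1) r = 0)
    (α : AddCircle (2 * π)) :
    ∀ᵐ θ : AddCircle (2 * π), (r : ℂ) * (AddCircle.toCircle (θ + α) : ℂ) ∉ N := by
  rw [cavg_rot _ _ α, lintegral_eq_zero_iff] at h
  · filter_upwards [h] with θ hθ hh
    simp [indicator_of_mem hh] at hθ
  · have h2 : Measurable (fun θ : AddCircle (2 * π) => (r, θ + α)) :=
      measurable_const.prodMk (measurable_id.add_const α)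
    exact (measurable_one.indicator hN).comp (measurable_pt.comp h2)

lemma cavg_le {g : ℂ → ℝ≥0∞} {N : Set ℂ} (hN : MeasurableSet N) {s s' a : ℝ}
    (C : ℝ≥0∞) (hC : C ≠ ∞) (hs : 0 < s) (hs' : 0 < s') (h1 : |s - s'| ≤ a)
    (h2 : a ≤ s + s') (gs : cavg (N.indicator 1) s = 0) (gs' : cavg (N.indicator 1) s' = 0)
    (H : ∀ z ∉ N, ∀ z' ∉ N, ‖z - z'‖ = a → g z ≤ C * g z') :
    cavg g s ≤ C * cavg g s' := by
  obtain ⟨α, hα⟩ := exists_angle hs hs' h1 h2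
  rw [cavg_rot g s α, cavg, ← lintegral_const_mul' _ _ hC]
  apply lintegral_mono_ae
  have := good_ae hN gs' 0
  simp only [add_zero] at this
  filter_upwards [good_ae hN gs α, this] with θ h h'
  apply H _ h _ h'
  rw [AddCircle.toCircle_add]
  exact hα _

/-- right upper averages -/
noncomputable def reg (G : ℝ → ℝ≥0∞) (r : ℝ) : ℝ≥0∞ :=
  limsup (fun h : ℝ => (∫⁻ t in Icc r (r + h), G t) / ENNReal.ofReal h) (𝓝[>] (0 : ℝ))

lemma reg_eq_of_int {G : ℝ → ℝ≥0∞} (hG : Measurable G) (hfin : ∫⁻ t, G t ≠ ∞) :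
    ∀ᵐ r, reg G r = G r := by
  filter_upwards [(IsUnifLocDoublingMeasure.vitaliFamily
    (volume : Measure ℝ) 1).ae_tendsto_lintegral_div' hG hfin] with r hr
  have h1 := hr.comp (Real.tendsto_Icc_vitaliFamily_right r)
  have h2 : Tendsto (fun h : ℝ => r + h) (𝓝[>] 0) (𝓝[>] r) := by
    apply tendsto_nhdsWithin_of_tendsto_nhds_of_eventually_within
    · have : Tendsto (fun h : ℝ => r + h) (𝓝 0) (𝓝 (r + 0)) :=
        (continuous_const.add continuous_id).tendsto 0
      rw [add_zero] at this
      exact this.mono_left nhdsWithin_le_nhds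
    · filter_upwards [self_mem_nhdsWithin] with h hh
      simpa using hh
  have h3 := (h1.comp h2).limsup_eq
  rw [← h3, reg]
  congr 1
  funext h
  simp [Function.comp_def]

lemma reg_congr {G G' : ℝ → ℝ≥0∞} {r : ℝ} (h : ∀ t, r ≤ t → G t = G' t) :
    reg G r = reg G' r := by
  unfold reg
  congr 1
  funext x
  congr 1
  apply setLIntegral_congr_fun measurableSet_Icc
  intro t ht
  exact h t ht.1

lemma reg_eq {G : ℝ → ℝ≥0∞} (hG : Measurable G)
    (hfin : ∫⁻ t in Ioi (0 : ℝ), ENNReal.ofReal t * G t ≠ ∞) :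
    ∀ᵐ r, 0 < r → reg G r = G r := by
  have key : ∀ n : ℕ, ∀ᵐ r, reg ((Ioi (1 / ((n : ℝ) + 1))).indicator G) r
      = (Ioi (1 / ((n : ℝ) + 1))).indicator G r := by
    intro n
    apply reg_eq_of_int (hG.indicator measurableSet_Ioi)
    have hn : (0 : ℝ) < 1 / ((n : ℝ) + 1) := by positivity
    have : ∫⁻ t, (Ioi (1 / ((n : ℝ) + 1))).indicator G t ≤
        ENNReal.ofReal ((n : ℝ) + 1) * ∫⁻ t in Ioi (0 : ℝ), ENNReal.ofReal t * G t := by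
      rw [← lintegral_const_mul' _ _ ENNReal.ofReal_ne_top, ← lintegral_indicator measurableSet_Ioi]
      apply lintegral_mono
      intro t
      by_cases ht : t ∈ Ioi (1 / ((n : ℝ) + 1))
      · have ht0 : t ∈ Ioi (0 : ℝ) := hn.trans ht
        rw [indicator_of_mem ht, indicator_of_mem ht0, ← mul_assoc,
          ← ENNReal.ofReal_mul (by positivity)]
        have : (1 : ℝ≥0∞) ≤ ENNReal.ofReal (((n : ℝ) + 1) * t) := by
          rw [ENNReal.one_le_ofReal]
          have h : 1 / ((n : ℝ) + 1) < t := ht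
          rw [div_lt_iff₀ (by positivity)] at h
          linarith
        calc G t = 1 * G t := (one_mul _).symm
          _ ≤ _ := by gcongr
      · rw [indicator_of_notMem ht]; exact zero_le
    exact (this.trans_lt (ENNReal.mul_lt_top ENNReal.ofReal_lt_top hfin.lt_top)).ne
  filter_upwards [ae_all_iff.2 key] with r hr hr0
  obtain ⟨n, hn⟩ := exists_nat_one_div_lt hr0
  have := hr n
  rw [indicator_of_mem (show r ∈ Ioi (1 / ((n : ℝ) + 1)) from hn)] at this
  rw [← this]
  apply reg_congr
  intro t ht
  rw [indicator_of_mem]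
  exact lt_of_lt_of_le hn ht

lemma reg_le {G : ℝ → ℝ≥0∞} {r r' : ℝ} {C : ℝ≥0∞} (hC : C ≠ ∞)
    (H : ∀ᵐ t, 0 < t → G (r + t) ≤ C * G (r' + t)) :
    reg G r ≤ C * reg G r' := by
  have shift : ∀ r h : ℝ, ∫⁻ t in Icc r (r + h), G t = ∫⁻ t in Icc 0 h, G (r + t) := by
    intro r h
    rw [← lintegral_indicator measurableSet_Icc, ← lintegral_indicator measurableSet_Icc,
      ← lintegral_add_left_eq_self _ r]
    apply lintegral_congr
    intro t
    by_cases ht : t ∈ Icc 0 h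
    · rw [indicator_of_mem ht, indicator_of_mem]
      exact ⟨by linarith [ht.1], by linarith [ht.2]⟩
    · rw [indicator_of_notMem ht, indicator_of_notMem]
      intro h'; exact ht ⟨by linarith [h'.1], by linarith [h'.2]⟩
  unfold reg
  rw [← ENNReal.limsup_const_mul_of_ne_top hC]
  refine limsup_le_limsup ?_
  · apply Eventually.of_forall
    intro h
    simp only [shift]
    rw [← mul_div_assoc]
    gcongr
    rw [← lintegral_const_mul' _ _ hC, ← restrict_Ioc_eq_restrict_Icc]
    apply lintegral_mono_ae
    refine (ae_restrict_iff' measurableSet_Ioc).2 ?_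
    filter_upwards [H] with t ht h'
    exact ht h'.1

lemma mem_V_iff (c : EuclideanSpace ℝ (Fin 2)) (ρ : ℝ) (u : EuclideanSpace ℝ (Fin 2)) :
    (∃ i ∈ Metric.closedBall c ρ, ∃ j ∈ Metric.closedBall c ρ, u = j - i) ↔ ‖u‖ ≤ 2 * ρ := by
  constructor
  · rintro ⟨i, hi, j, hj, rfl⟩
    rw [← dist_eq_norm]
    have := dist_triangle_right j i c
    have h1 := Metric.mem_closedBall.1 hi
    have h2 := Metric.mem_closedBall.1 hj
    linarith
  · intro h
    have hn : ‖(1 / 2 : ℝ) • u‖ ≤ ρ := by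
      rw [norm_smul]; norm_num; linarith
    refine ⟨c - (1 / 2 : ℝ) • u, ?_, c + (1 / 2 : ℝ) • u, ?_, ?_⟩
    · simpa [Metric.mem_closedBall, dist_eq_norm, norm_neg] using hn
    · simpa [Metric.mem_closedBall, dist_eq_norm] using hn
    · module

/-- passing to the infimum -/
lemma le_exp_sInf {x y : ℝ} (hx : 0 ≤ x) (hy : 0 ≤ y) {S : Set ℝ} (hS : S.Nonempty)
    (h : ∀ z ∈ S, x ≤ Real.exp z * y) : x ≤ Real.exp (sInf S) * y := by
  rcases hx.eq_or_lt with rfl | hx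
  · positivity
  · have hy' : 0 < y := by
      rcases hy.eq_or_lt with rfl | hy
      · obtain ⟨z, hz⟩ := hS
        have := h z hz
        simp at this; linarith
      · exact hy
    have : Real.log (x / y) ≤ sInf S := by
      apply le_csInf hS
      intro z hz
      rw [Real.log_le_iff_le_exp (by positivity), div_le_iff₀ hy']
      exact h z hz
    rwa [Real.log_le_iff_le_exp (by positivity), div_le_iff₀ hy'] at this

lemma toReal_le_of {a b : ℝ≥0∞} {z : ℝ} (h1 : a ≤ ENNReal.ofReal (Real.exp z) * b)
    (h2 : b ≤ ENNReal.ofReal (Real.exp z) * a) : a.toReal ≤ Real.exp z * b.toReal := by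
  by_cases ha : a = ∞
  · simp only [ha, ENNReal.toReal_top]; positivity
  · have hb : b ≠ ∞ :=
      (h2.trans_lt (ENNReal.mul_lt_top ENNReal.ofReal_lt_top (lt_top_iff_ne_top.2 ha))).ne
    have := ENNReal.toReal_mono (ENNReal.mul_ne_top ENNReal.ofReal_ne_top hb) h1
    rwa [ENNReal.toReal_mul, ENNReal.toReal_ofReal (Real.exp_pos _).le] at this

lemma lintegral_transport (F : EuclideanSpace ℝ (Fin 2) → ℝ≥0∞) :
    ∫⁻ v, F v = ∫⁻ z : ℂ, F (Complex.orthonormalBasisOneI.repr z) :=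
  ((Complex.orthonormalBasisOneI.repr.measurePreserving).lintegral_comp_emb
    Complex.orthonormalBasisOneI.repr.toHomeomorph.measurableEmbedding F).symm

/-- weighted integrals agree -/
lemma lintegral_reg {g : ℂ → ℝ≥0∞} (hg : Measurable g) (hfin : ∫⁻ z, g z ≠ ∞)
    {L : ℝ → ℝ} (hL : Measurable L) :
    ∫⁻ z : ℂ, ENNReal.ofReal ((reg (fun r => cavg g r / ENNReal.ofReal (2 * π)) ‖z‖).toReal * L ‖z‖)
      = ∫⁻ z, g z * ENNReal.ofReal (L ‖z‖) := by
  set G : ℝ → ℝ≥0∞ := fun r => cavg g r / ENNReal.ofReal (2 * π) with hGdef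
  have hcm := measurable_cavg hg
  have hGm : Measurable G := hcm.div_const _
  have hpi0 : ENNReal.ofReal (2 * π) ≠ 0 := by
    simp only [ne_eq, ENNReal.ofReal_eq_zero, not_le]; exact Real.two_pi_pos
  have hcG : ∀ r, G r * ENNReal.ofReal (2 * π) = cavg g r := fun r =>
    ENNReal.div_mul_cancel hpi0 ENNReal.ofReal_ne_top
  have hp := lintegral_polar hg
  have hfin1 : ∫⁻ r in Ioi (0 : ℝ), ENNReal.ofReal r * cavg g r ≠ ∞ := hp ▸ hfin
  have hfin2 : ∫⁻ r in Ioi (0 : ℝ), ENNReal.ofReal r * G r ≠ ∞ := by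
    have : ∀ r, ENNReal.ofReal r * G r
        = ENNReal.ofReal r * cavg g r * (ENNReal.ofReal (2 * π))⁻¹ := by
      intro r; simp only [hGdef, div_eq_mul_inv, mul_assoc]
    simp only [this]
    rw [lintegral_mul_const' _ _ (ENNReal.inv_ne_top.2 hpi0)]
    exact ENNReal.mul_ne_top hfin1 (ENNReal.inv_ne_top.2 hpi0)
  have hae := reg_eq hGm hfin2
  have hlt : ∀ᵐ r, 0 < r → G r ≠ ∞ := by
    have h := ae_lt_top' (μ := volume.restrict (Ioi (0 : ℝ)))
      (f := fun r => ENNReal.ofReal r * G r)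
      (ENNReal.measurable_ofReal.mul hGm).aemeasurable hfin2
    have h := (ae_restrict_iff' measurableSet_Ioi).1 h
    filter_upwards [h] with r hr hr0 htop
    have := hr hr0
    rw [htop, ENNReal.mul_top] at this
    · exact lt_irrefl _ this
    · simpa using hr0
  have hEq : (fun r => ENNReal.ofReal ((reg G r).toReal * L r))
      =ᵐ[volume.restrict (Ioi (0 : ℝ))] fun r => G r * ENNReal.ofReal (L r) := by
    refine (ae_restrict_iff' measurableSet_Ioi).2 ?_
    filter_upwards [hae, hlt] with r h1 h2 hr
    rw [h1 hr, ENNReal.ofReal_mul ENNReal.toReal_nonneg, ENNReal.ofReal_toReal (h2 hr)]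
  have hm0 : Measurable (fun r => G r * ENNReal.ofReal (L r)) :=
    hGm.mul (ENNReal.measurable_ofReal.comp hL)
  rw [lintegral_radial (h := fun r => ENNReal.ofReal ((reg G r).toReal * L r))
    (hm0.aemeasurable.congr hEq.symm),
    lintegral_polar (g := fun z => g z * ENNReal.ofReal (L ‖z‖)) (hg.mul (ENNReal.measurable_ofReal.comp (hL.comp measurable_norm)))]
  apply lintegral_congr_ae
  filter_upwards [hEq, ae_restrict_mem measurableSet_Ioi] with r hr hr0
  rw [hr]
  congr 1
  have : cavg (fun z => g z * ENNReal.ofReal (L ‖z‖)) r = cavg g r * ENNReal.ofReal (L r) := by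
    unfold cavg
    rw [← lintegral_mul_const' _ _ ENNReal.ofReal_ne_top]
    apply lintegral_congr
    intro θ
    have hnorm : ‖(r : ℂ) * (AddCircle.toCircle θ : ℂ)‖ = r := by
      rw [norm_mul, Circle.norm_coe, mul_one, Complex.norm_real, Real.norm_eq_abs,
        abs_of_pos (show 0 < r from hr0)]
    beta_reduce
    rw [hnorm]
  refine Eq.trans ?_ this.symm
  rw [← hcG]
  ring

end helpers




/-- Generality of circular noise functions. If `ℓ` is regular and `X` is
a closed disk, then for every noise function `f` satisfying `ℓ`-privacy on `X` and every
measurable loss function, there is a radial `R` whose circular noise function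
`v ↦ R ‖v‖` is a probability density with the same expected loss as `f` and strictly
satisfies `ℓ`-privacy on `X`: `R r ≤ exp (ℓ_X (r, r')) * R r'` for ALL `(r, r') ∈ D_X`. -/
theorem circular_noise_functions_suffice
    (ℓ : ℝ → ℝ) (hℓ_nonneg : ∀ d : ℝ, 0 ≤ d → 0 ≤ ℓ d)
    (hℓ_reg : ∀ v₁ v₂ v₃ : EuclideanSpace ℝ (Fin 2),
      ℓ ‖v₁ - v₃‖ ≤ ℓ ‖v₁ - v₂‖ + ℓ ‖v₂ - v₃‖)
    (c : EuclideanSpace ℝ (Fin 2)) (ρ : ℝ) (hρ : 0 ≤ ρ)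
    (X : Set (EuclideanSpace ℝ (Fin 2))) (hX : X = Metric.closedBall c ρ)
    (f : EuclideanSpace ℝ (Fin 2) → ℝ) (hf_meas : Measurable f)
    (hf_nonneg : ∀ v, 0 ≤ f v)
    (hf_density : ∫⁻ v : EuclideanSpace ℝ (Fin 2), ENNReal.ofReal (f v) ∂volume = 1)
    (hf_priv : ∃ N : Set (EuclideanSpace ℝ (Fin 2)), volume N = 0 ∧
      ∀ v ∉ N, ∀ v' ∉ N,
        v - v' ∈ {u : EuclideanSpace ℝ (Fin 2) | ∃ i ∈ X, ∃ j ∈ X, u = j - i} →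
          f v ≤ Real.exp (ℓ ‖v - v'‖) * f v')
    (loss : ℝ → ℝ) (hloss_meas : Measurable loss)
    (hloss_nonneg : ∀ r, 0 ≤ r → 0 ≤ loss r) :
    ∃ R : ℝ → ℝ, (∀ r, 0 ≤ R r) ∧
      (∫⁻ v : EuclideanSpace ℝ (Fin 2), ENNReal.ofReal (R ‖v‖) ∂volume = 1) ∧
      (∫⁻ v : EuclideanSpace ℝ (Fin 2), ENNReal.ofReal (R ‖v‖ * loss ‖v‖) ∂volume
        = ∫⁻ v : EuclideanSpace ℝ (Fin 2), ENNReal.ofReal (f v * loss ‖v‖) ∂volume) ∧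
      (∀ r r' : ℝ,
        (r, r') ∈ {p : ℝ × ℝ | ∃ v v' : EuclideanSpace ℝ (Fin 2),
            p.1 = ‖v‖ ∧ p.2 = ‖v'‖ ∧
            v' - v ∈ {u : EuclideanSpace ℝ (Fin 2) | ∃ i ∈ X, ∃ j ∈ X, u = j - i}} →
          R r ≤ Real.exp (sInf {z : ℝ | ∃ v v' : EuclideanSpace ℝ (Fin 2),
              ‖v‖ = r ∧ ‖v'‖ = r' ∧
              v - v' ∈ {u : EuclideanSpace ℝ (Fin 2) | ∃ i ∈ X, ∃ j ∈ X, u = j - i} ∧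
              z = ℓ ‖v - v'‖}) * R r') := by
  classical
  subst hX
  obtain ⟨N, hN0, hN⟩ := hf_priv
  simp only [Set.mem_setOf_eq, mem_V_iff] at hN ⊢
  let e := Complex.orthonormalBasisOneI.repr
  let g : ℂ → ENNReal := fun z => ENNReal.ofReal (f (e z))
  have hem : Measurable e := e.continuous.measurable
  have hg : Measurable g := ENNReal.measurable_ofReal.comp (hf_meas.comp hem)
  have hg1 : ∫⁻ z, g z = 1 := by
    rw [← hf_density, lintegral_transport]
  have hgfin : ∫⁻ z, g z ≠ ⊤ := by rw [hg1]; exact ENNReal.one_ne_top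
  let G : ℝ → ENNReal := fun r => cavg g r / ENNReal.ofReal (2 * π)
  -- null set on ℂ
  let M : Set ℂ := e ⁻¹' (toMeasurable volume N)
  have hMm : MeasurableSet M := hem (measurableSet_toMeasurable _ _)
  have hM0 : volume M = 0 := by
    rw [(e.measurePreserving).measure_preimage (measurableSet_toMeasurable _ _).nullMeasurableSet,
      measure_toMeasurable, hN0]
  have hgood := ae_good hMm hM0
  -- main inequality
  have main : ∀ r r' a : ℝ, 0 ≤ r → 0 ≤ r' → |r - r'| ≤ a → a ≤ r + r' → a ≤ 2 * ρ →
      reg G r ≤ ENNReal.ofReal (Real.exp (ℓ a)) * reg G r' := by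
    intro r r' a hr hr' h1 h2 h3
    apply reg_le ENNReal.ofReal_ne_top
    have q : ∀ r : ℝ, ∀ᵐ t ∂(volume : Measure ℝ), 0 < r + t →
        cavg (M.indicator 1) (r + t) = 0 := fun r =>
      (measurePreserving_add_left volume r).quasiMeasurePreserving.ae hgood
    filter_upwards [q r, q r'] with t g1 g2 ht
    have := cavg_le (g := g) hMm (s := r + t) (s' := r' + t) (a := a)
      (ENNReal.ofReal (Real.exp (ℓ a))) ENNReal.ofReal_ne_top (by linarith) (by linarith)
      (by rwa [add_sub_add_right_eq_sub]) (by linarith) (g1 (by linarith)) (g2 (by linarith)) ?_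
    · show _ / _ ≤ _ * (_ / _)
      rw [← mul_div_assoc]
      exact ENNReal.div_le_div_right this _
    · intro z hz z' hz' hzz
      have hd : ‖e z - e z'‖ = a := by rw [← map_sub, e.norm_map, hzz]
      have := hN (e z) (fun h => hz (subset_toMeasurable _ _ h)) (e z')
        (fun h => hz' (subset_toMeasurable _ _ h)) (by rw [hd]; exact h3)
      rw [hd] at this
      show ENNReal.ofReal _ ≤ _ * ENNReal.ofReal _
      rw [← ENNReal.ofReal_mul (Real.exp_pos _).le]
      exact ENNReal.ofReal_le_ofReal this
  refine ⟨fun r => (reg G r).toReal, fun r => ENNReal.toReal_nonneg, ?_, ?_, ?_⟩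
  · have h := lintegral_reg hg hgfin (L := fun _ => 1) measurable_const
    simp only [mul_one, ENNReal.ofReal_one] at h
    rw [lintegral_transport, ← hg1, ← h]
    simp only [LinearIsometryEquiv.norm_map]
    rfl
  · have h := lintegral_reg hg hgfin hloss_meas
    rw [lintegral_transport, lintegral_transport (fun v => ENNReal.ofReal (f v * loss ‖v‖))]
    simp only [LinearIsometryEquiv.norm_map]
    refine Eq.trans h ?_
    apply lintegral_congr
    intro z
    rw [ENNReal.ofReal_mul (hf_nonneg _)]
  · rintro r r' ⟨v, v', hv, hv', hvv⟩
    apply le_exp_sInf ENNReal.toReal_nonneg ENNReal.toReal_nonneg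
    · exact ⟨_, v, v', hv.symm, hv'.symm, by rwa [norm_sub_rev], rfl⟩
    · rintro z ⟨w, w', rfl, rfl, hww, rfl⟩
      have h1 := abs_norm_sub_norm_le w w'
      have h2 := norm_sub_le w w'
      apply toReal_le_of
      · exact main _ _ _ (norm_nonneg _) (norm_nonneg _) h1 h2 hww
      · exact main _ _ _ (norm_nonneg _) (norm_nonneg _) (by rwa [abs_sub_comm]) (by linarith) hww
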